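/- Let I be a square-free monomial ideal in R = k[x_1,…,x_n] and let (f_{-1},f_0,…,f_d) be the f-vector of the non-face complex δ_N(I), with the convention f_i = 0 for i > d. Then the f-vector of the facet complex δ_F(Î) of the Newton complementary dual Î satisfies f_j(δ_F(Î)) = C(n, j+1) − f_{n−j−2}(δ_N(I)) for all j = −1, 0, …, n−1, i.e., f(δ_F(Î)) = (C(n,0) − f_{n−1}, …, C(n,i) − f_{n−i−1}, …, C(n,n−1) − f_0, C(n,n) − f_{−1}). -/

import Mathlib

/-!
Encoding: a squarefree monomial of `k[x₁,…,xₙ]` is encoded by its support, a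
`Finset (Fin n)` (the monomial `∏ i ∈ T, xᵢ` corresponds to `T`); its degree is
`T.card`, and divisibility of squarefree monomials is inclusion of supports.
A squarefree monomial ideal `I` is encoded by the antichain
`G : Finset (Finset (Fin n))` of supports of its unique minimal set of monomial
generators `G(I)`; the squarefree monomial with support `T` lies in `I` iff
`S ⊆ T` for some `S ∈ G`.
-/

open Finset

/-- The squarefree monomial with support `T` belongs to the squarefree monomial
ideal with minimal generating supports `G`. -/
def memIdeal {n : ℕ} (G : Finset (Finset (Fin n))) (T : Finset (Fin n)) : Prop :=
  ∃ S ∈ G, S ⊆ T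

/-- The Newton complementary dual `Î = ⟨(x₁⋯xₙ)/m : m ∈ G(I)⟩`: each minimal
generator support `S` is replaced by its complement `Sᶜ`, the support of
`(x₁⋯xₙ)/(∏ i ∈ S, xᵢ)`. -/
def ncDual {n : ℕ} (G : Finset (Finset (Fin n))) : Finset (Finset (Fin n)) :=
  G.image fun S => Sᶜ

/-- `faceN G d` is the number of faces of cardinality `d` (i.e. of dimension
`d - 1`) of the non-face (Stanley–Reisner) complex `δ_N(I)`, whose faces are the
supports of squarefree monomials not in `I`.  Thus `faceN G (j + 1)` is the
f-vector entry `f_j(δ_N(I))`, and trailing entries are `0`. -/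
noncomputable def faceN {n : ℕ} (G : Finset (Finset (Fin n))) (d : ℕ) : ℕ :=
  Nat.card {T : Finset (Fin n) | T.card = d ∧ ¬ memIdeal G T}

/-- `faceF G d` is the number of faces of cardinality `d` (i.e. of dimension
`d - 1`) of the facet complex `δ_F(I)`, whose faces are the subsets of the
supports of the minimal generators.  Thus `faceF G (j + 1)` is the f-vector
entry `f_j(δ_F(I))`, and trailing entries are `0`. -/
noncomputable def faceF {n : ℕ} (G : Finset (Finset (Fin n))) (d : ℕ) : ℕ :=
  Nat.card {T : Finset (Fin n) | T.card = d ∧ ∃ S ∈ G, T ⊆ S}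

/-- `I` is an f-ideal iff `δ_N(I)` and `δ_F(I)` have the same f-vector. -/
def IsFIdeal {n : ℕ} (G : Finset (Finset (Fin n))) : Prop :=
  ∀ d : ℕ, faceN G d = faceF G d

/-- If `(f₋₁, f₀, …, f_d)` is the f-vector of the non-face complex `δ_N(I)` (with
`f_i = 0` for `i > d`), then for all `-1 ≤ j ≤ n - 1` the f-vector of the facet
complex of the Newton complementary dual satisfies
`f_j(δ_F(Î)) = C(n, j+1) - f_{n-j-2}(δ_N(I))`.  (Recall that the f-vector entry
at dimension `j` is the face count at cardinality `j + 1`.) -/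
theorem fvector_facet_ncDual {n : ℕ} (G : Finset (Finset (Fin n)))
    (hG : IsAntichain (· ⊆ ·) (G : Set (Finset (Fin n)))) :
    ∀ j : ℤ, -1 ≤ j → j ≤ (n : ℤ) - 1 →
      (faceF (ncDual G) (j + 1).toNat : ℤ)
        = (n.choose (j + 1).toNat : ℤ) - (faceN G ((n : ℤ) - j - 1).toNat : ℤ) := by
  intro j h1 h2
  obtain ⟨d, hd⟩ : ∃ d : ℕ, (d : ℤ) = j + 1 := ⟨(j + 1).toNat, by omega⟩
  have e1 : (j + 1).toNat = d := by omega
  have e2 : ((n : ℤ) - j - 1).toNat = n - d := by omega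
  have hdn : d ≤ n := by omega
  rw [e1, e2]
  classical
  have hF : faceF (ncDual G) d
      = ((powersetCard d (univ : Finset (Fin n))).filter (fun T => memIdeal G Tᶜ)).card := by
    unfold faceF
    rw [Nat.card_coe_set_eq, ← Set.ncard_coe_finset]
    congr 1
    ext T
    simp only [Set.mem_ofPred_eq, ncDual, mem_image, mem_coe, mem_filter, mem_powersetCard,
      subset_univ, true_and]
    refine and_congr_right fun _ => ⟨?_, ?_⟩
    · rintro ⟨_, ⟨S, hS, rfl⟩, h⟩
      exact ⟨S, hS, subset_compl_comm.mp h⟩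
    · rintro ⟨S, hS, h⟩
      exact ⟨_, ⟨S, hS, rfl⟩, subset_compl_comm.mp h⟩
  have hN : faceN G (n - d)
      = ((powersetCard d (univ : Finset (Fin n))).filter (fun T => ¬ memIdeal G Tᶜ)).card := by
    unfold faceN
    rw [Nat.card_coe_set_eq, ← Set.ncard_coe_finset,
      ← Set.ncard_image_of_injective _ (compl_injective (α := Finset (Fin n)))]
    congr 1
    ext T
    simp only [Set.mem_image, Set.mem_ofPred_eq, mem_coe, mem_filter, mem_powersetCard,
      subset_univ, true_and]
    constructor
    · rintro ⟨S, ⟨hS, h⟩, rfl⟩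
      rw [compl_compl, card_compl, Fintype.card_fin]
      exact ⟨by omega, h⟩
    · rintro ⟨hT, h⟩
      exact ⟨Tᶜ, ⟨by rw [card_compl, Fintype.card_fin, hT], h⟩, compl_compl T⟩
  have key := card_filter_add_card_filter_not (s := powersetCard d (univ : Finset (Fin n)))
    (fun T => memIdeal G Tᶜ)
  rw [← hF, ← hN, card_powersetCard, card_univ, Fintype.card_fin] at key
  omega
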